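/- An indecomposable object S of an abelian length category 𝒜 is simple if and only if there exists a length function ℓ on 𝒜 such that ℓ*(S) ≤ ℓ*(X) for every indecomposable object X, where ℓ* is the Gabriel-Roiter measure with respect to ℓ. -/

import Mathlib

open CategoryTheory CategoryTheory.Limits

/-- The lexicographic order on finite chains (here: finite subsets of a linear order):
`X ≤ Y` iff `min (Y \ X) ≤ min (X \ Y)`, with the convention `max ∅ < x < min ∅`. -/
def lexLE {T : Type*} [PartialOrder T] [DecidableEq T] (X Y : Finset T) : Prop :=
  X \ Y = ∅ ∨ ∃ b ∈ Y \ X, ∀ a ∈ X \ Y, b ≤ a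

def lexLT {T : Type*} [PartialOrder T] [DecidableEq T] (X Y : Finset T) : Prop :=
  lexLE X Y ∧ ¬ lexLE Y X

universe v u

variable (C : Type u) [Category.{v} C] [Abelian C]

/-- The abelian category is a length category: every object is artinian and noetherian,
i.e. its subobject lattice satisfies both chain conditions (equivalently, every object
has a finite composition series). -/
def IsLengthCategory : Prop :=
  ∀ X : C, WellFoundedLT (Subobject X) ∧ WellFoundedGT (Subobject X)

variable {C}

/-- `X` is (isomorphic to) a subobject of `Y`. -/
def SubOf (X Y : C) : Prop := ∃ f : X ⟶ Y, Mono f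

/-- `X` is a proper subobject of `Y` (strict order on the poset of isoclasses of
indecomposables ordered by the subobject relation). -/
def StrictSubOf (X Y : C) : Prop := SubOf X Y ∧ ¬ SubOf Y X

/-- `X` is indecomposable: nonzero, and any biproduct decomposition has a zero summand. -/
def Indec (X : C) : Prop :=
  ¬ IsZero X ∧ ∀ A B : C, Nonempty (X ≅ A ⊞ B) → IsZero A ∨ IsZero B

/-- A length function on an abelian length category: real-valued, nonnegative, zero
exactly on zero objects, and additive on short exact sequences. -/
def IsLengthFunctionCat (l : C → ℝ) : Prop :=
  (∀ X : C, 0 ≤ l X) ∧ (∀ X : C, l X = 0 ↔ IsZero X) ∧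
  (∀ Sc : ShortComplex C, Sc.ShortExact → l Sc.X₂ = l Sc.X₁ + l Sc.X₃)

/-- `μ` is the Gabriel-Roiter measure `ℓ*` with respect to `l`: for each
indecomposable `X`, `μ X ∈ Ch(ℝ)` is the lexicographic maximum of the sets
`{l X₁, …, l Xₙ}` over all chains `X₁ ⊂ X₂ ⊂ ⋯ ⊂ Xₙ = X` of indecomposable
subobjects of `X`. -/
def IsGRMeasure (l : C → ℝ) (μ : C → Finset ℝ) : Prop :=
  ∀ X : C, Indec X →
    (∃ (n : ℕ) (Z : Fin (n + 1) → C), (∀ i, Indec (Z i)) ∧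
      (∀ i j : Fin (n + 1), i < j → StrictSubOf (Z i) (Z j)) ∧ Z (Fin.last n) = X ∧
      μ X = Finset.univ.image fun i => l (Z i)) ∧
    (∀ (n : ℕ) (Z : Fin (n + 1) → C), (∀ i, Indec (Z i)) →
      (∀ i j : Fin (n + 1), i < j → StrictSubOf (Z i) (Z j)) → Z (Fin.last n) = X →
      lexLE (Finset.univ.image fun i => l (Z i)) (μ X))

/-- If `f`, `g` is a short exact sequence and `s` a morphism out of its last term, then the
kernels of `g ≫ s` and `s` fit into a short exact sequence with the first term. -/
theorem shortExact_kernel_comp {X Y Z T : C} {f : Y ⟶ X} {g : X ⟶ Z} {w : f ≫ g = 0}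
    (h : (ShortComplex.mk f g w).ShortExact) (s : Z ⟶ T) :
    (ShortComplex.mk (kernel.lift (g ≫ s) f (by rw [reassoc_of% w, zero_comp]))
      (kernel.map (g ≫ s) s g (𝟙 T) (by simp))
      (by ext; simp [w])).ShortExact := by
  have hf : Mono f := h.mono_f
  have hg : Epi g := h.epi_g
  refine ShortComplex.ShortExact.mk' ?_ ?_ ?_
  · rw [ShortComplex.exact_iff_exact_up_to_refinements]
    intro A x hx
    dsimp at x hx ⊢
    have hx' : (x ≫ kernel.ι (g ≫ s)) ≫ g = 0 := by
      simpa using hx =≫ kernel.ι s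
    exact ⟨A, 𝟙 A, inferInstance, h.exact.lift _ hx', by
      ext
      simpa using (h.exact.lift_f _ hx').symm⟩
  · exact mono_of_mono_fac (kernel.lift_ι (g ≫ s) f _)
  · rw [epi_iff_surjective_up_to_refinements]
    intro A y
    dsimp at y ⊢
    obtain ⟨A', p, hp, x, hx⟩ :=
      (epi_iff_surjective_up_to_refinements g).1 inferInstance (y ≫ kernel.ι s)
    refine ⟨A', p, hp, kernel.lift _ x ?_, ?_⟩
    · rw [← reassoc_of% hx]
      simp
    · ext
      simpa using hx

/-- If `f`, `g` is a short exact sequence and `t` is a morphism out of its middle term such that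
`f ≫ t` is an epimorphism, then the kernels of `f ≫ t` and `t` fit into a short exact sequence
with the last term. -/
theorem shortExact_kernel_of_epi_comp {X Y Z T : C} {f : Y ⟶ X} {g : X ⟶ Z} {w : f ≫ g = 0}
    (h : (ShortComplex.mk f g w).ShortExact) (t : X ⟶ T) [Epi (f ≫ t)] :
    (ShortComplex.mk (kernel.map (f ≫ t) t f (𝟙 T) (by simp)) (kernel.ι t ≫ g)
      (by simp [w])).ShortExact := by
  have hf : Mono f := h.mono_f
  have hg : Epi g := h.epi_g
  refine ShortComplex.ShortExact.mk' ?_ ?_ ?_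
  · rw [ShortComplex.exact_iff_exact_up_to_refinements]
    intro A x hx
    dsimp at x hx ⊢
    have hx' : (x ≫ kernel.ι t) ≫ g = 0 := by simpa using hx
    have hl : h.exact.lift _ hx' ≫ f = x ≫ kernel.ι t := h.exact.lift_f _ hx'
    refine ⟨A, 𝟙 A, inferInstance, kernel.lift _ (h.exact.lift _ hx') ?_, ?_⟩
    · rw [reassoc_of% hl]
      simp
    · ext
      simpa using hl.symm
  · have : Mono (kernel.map (f ≫ t) t f (𝟙 T) (by simp) ≫ kernel.ι t) := by
      rw [kernel.lift_ι]
      infer_instance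
    exact mono_of_mono _ (kernel.ι t)
  · rw [epi_iff_surjective_up_to_refinements]
    intro A z
    dsimp at z ⊢
    obtain ⟨A₁, p, hp, x, hx⟩ := (epi_iff_surjective_up_to_refinements g).1 inferInstance z
    obtain ⟨A₂, q, hq, y, hy⟩ :=
      (epi_iff_surjective_up_to_refinements (f ≫ t)).1 inferInstance (x ≫ t)
    refine ⟨A₂, q ≫ p, epi_comp _ _, kernel.lift t (q ≫ x - y ≫ f) ?_, ?_⟩
    · simp [hy]
    · simp [hx, w]

/-- `HasLength X n` means that `X` has a composition series of length `n`. -/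
inductive HasLength : C → ℕ → Prop
  | zero {X : C} (hX : IsZero X) : HasLength X 0
  | succ {X T : C} {n : ℕ} (t : X ⟶ T) (ht : Epi t) (hT : Simple T)
      (hn : HasLength (kernel t) n) : HasLength X (n + 1)

namespace HasLength

theorem of_iso {X Y : C} {n : ℕ} (h : HasLength X n) (e : X ≅ Y) : HasLength Y n := by
  induction h generalizing Y with
  | zero hX => exact .zero (hX.of_iso e.symm)
  | succ t ht hT _ ih =>
    exact .succ (e.inv ≫ t) (epi_comp _ _) hT (ih (kernelIsIsoComp e.inv t).symm)

theorem of_shortExact {S : ShortComplex C} (h : S.ShortExact) {n : ℕ} (hn : HasLength S.X₁ n)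
    (hT : Simple S.X₃) : HasLength S.X₂ (n + 1) :=
  .succ S.g h.epi_g hT
    (hn.of_iso (IsLimit.conePointUniqueUpToIso h.fIsKernel (limit.isLimit _)))

theorem eq_zero {X : C} {n : ℕ} (h : HasLength X n) (hX : IsZero X) : n = 0 := by
  cases h with
  | zero _ => rfl
  | succ t ht hT _ => exact absurd (hX.of_epi t) (Simple.not_isZero _)

theorem isZero {X : C} (h : HasLength X 0) : IsZero X := by
  cases h with
  | zero hX => exact hX

theorem eq_one {X : C} [Simple X] {n : ℕ} (h : HasLength X n) : n = 1 := by
  cases h with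
  | zero hX => exact absurd hX (Simple.not_isZero X)
  | succ t ht hT hn =>
    have : t ≠ 0 := fun h0 => Simple.not_isZero _ (IsZero.of_epi_eq_zero t h0)
    have := isIso_of_epi_of_nonzero this
    rw [hn.eq_zero (isZero_kernel_of_mono t)]

theorem exists_of_shortExact {X : C} {n : ℕ} (hn : HasLength X n) :
    ∀ {Y Z : C} {f : Y ⟶ X} {g : X ⟶ Z} {w : f ≫ g = 0}, (ShortComplex.mk f g w).ShortExact →
      ∃ k m, HasLength Y k ∧ HasLength Z m ∧ k + m = n := by
  induction hn with
  | zero hX =>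
    intro Y Z f g w h
    have hf : Mono f := h.mono_f
    have hg : Epi g := h.epi_g
    exact ⟨0, 0, .zero (hX.of_mono f), .zero (hX.of_epi g), rfl⟩
  | succ t ht hT _ ih =>
    intro Y Z f g w h
    have hg : Epi g := h.epi_g
    by_cases h0 : f ≫ t = 0
    · obtain ⟨s, rfl⟩ : ∃ s, g ≫ s = t := ⟨h.exact.desc t h0, h.exact.g_desc t h0⟩
      obtain ⟨k, m, hk, hm, rfl⟩ := ih (shortExact_kernel_comp h s)
      exact ⟨k, m + 1, hk, .succ s (epi_of_epi g s) hT hm, rfl⟩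
    · have := epi_of_nonzero_to_simple h0
      obtain ⟨k, m, hk, hm, rfl⟩ := ih (shortExact_kernel_of_epi_comp h t)
      exact ⟨k + 1, m, .succ (f ≫ t) this hT hk, hm, by omega⟩

theorem unique {X : C} {n m : ℕ} (hn : HasLength X n) (hm : HasLength X m) : n = m := by
  induction hm generalizing n with
  | zero hX => exact hn.eq_zero hX
  | succ t ht hT _ ih =>
    obtain ⟨k, j, hk, hj, rfl⟩ := hn.exists_of_shortExact
      (ShortComplex.ShortExact.mk' (ShortComplex.kernelSequence_exact t) inferInstance ht)
    rw [ih hk, hj.eq_one]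

theorem exists_of_isLengthCategory (hC : IsLengthCategory C) (X : C) : ∃ n, HasLength X n := by
  have := (hC X).2
  obtain ⟨Y, ⟨n, hn⟩, hmax⟩ := WellFounded.has_min
    (wellFounded_gt (α := Subobject X)) {Y | ∃ n, HasLength (Y : C) n}
    ⟨⊥, 0, .zero ((isZero_zero C).of_iso Subobject.botCoeIsoZero)⟩
  by_cases hQ : IsZero (cokernel Y.arrow)
  · have : Epi Y.arrow := Preadditive.epi_of_isZero_cokernel _ hQ
    have := isIso_of_mono_of_epi Y.arrow
    exact ⟨n, hn.of_iso (asIso Y.arrow)⟩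
  · have : IsArtinianObject (cokernel Y.arrow) := ⟨(hC _).1⟩
    obtain ⟨T, hT⟩ := exists_simple_subobject hQ
    have hY : (ShortComplex.mk Y.arrow (cokernel.π Y.arrow) (cokernel.condition _)).ShortExact :=
      ShortComplex.ShortExact.mk' (ShortComplex.cokernelSequence_exact _) inferInstance
        inferInstance
    have hS := shortExact_kernel_comp hY (cokernel.π T.arrow)
    have hK : Simple (kernel (cokernel.π T.arrow)) :=
      Simple.of_iso (Y := (T : C)) (IsLimit.conePointUniqueUpToIso (limit.isLimit _)
        (Abelian.monoIsKernelOfCokernel _ (colimit.isColimit (parallelPair T.arrow 0))))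
    refine absurd ?_ (hmax (Subobject.mk (kernel.ι (cokernel.π Y.arrow ≫ cokernel.π T.arrow)))
      ⟨n + 1, (of_shortExact hS hn hK).of_iso (Subobject.underlyingIso _).symm⟩)
    refine lt_of_le_not_ge (Subobject.le_mk_of_comm _ (kernel.lift_ι _ Y.arrow (by simp))) ?_
    intro hle
    have he : Epi (kernel.map (cokernel.π Y.arrow ≫ cokernel.π T.arrow) (cokernel.π T.arrow)
      (cokernel.π Y.arrow) (𝟙 _) (by simp)) := hS.epi_g
    refine Simple.not_isZero _ (IsZero.of_epi_eq_zero (kernel.map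
      (cokernel.π Y.arrow ≫ cokernel.π T.arrow) (cokernel.π T.arrow) (cokernel.π Y.arrow) (𝟙 _)
      _) ?_)
    ext
    rw [kernel.lift_ι, zero_comp, ← Subobject.ofMkLE_arrow hle, Category.assoc,
      cokernel.condition, comp_zero]

end HasLength

/-- Composition length is a length function on an abelian length category. -/
theorem exists_isLengthFunctionCat_natCast (hC : IsLengthCategory C) :
    ∃ l : C → ℕ, IsLengthFunctionCat (fun X => (l X : ℝ)) ∧ ∀ X : C, Simple X → l X = 1 := by
  choose l hl using HasLength.exists_of_isLengthCategory hC
  refine ⟨l, ⟨fun X => Nat.cast_nonneg _, fun X => ?_, fun S hS => ?_⟩, fun X _ => (hl X).eq_one⟩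
  · rw [Nat.cast_eq_zero]
    exact ⟨fun h => (h ▸ hl X : HasLength X 0).isZero, (hl X).eq_zero⟩
  · obtain ⟨k, m, hk, hm, h⟩ := (hl S.X₂).exists_of_shortExact hS
    rw [hk.unique (hl _), hm.unique (hl _)] at h
    beta_reduce
    exact_mod_cast h.symm

namespace IsLengthFunctionCat

variable {l : C → ℝ}

theorem eq_add_cokernel (hl : IsLengthFunctionCat l) {X Y : C} (f : X ⟶ Y) [Mono f] :
    l Y = l X + l (cokernel f) :=
  hl.2.2 _ (ShortComplex.ShortExact.mk' (ShortComplex.cokernelSequence_exact f)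
    (inferInstanceAs (Mono f)) (inferInstanceAs (Epi (cokernel.π f))))

theorem le_of_subOf (hl : IsLengthFunctionCat l) {X Y : C} (h : SubOf X Y) : l X ≤ l Y := by
  obtain ⟨f, hf⟩ := h
  linarith [hl.eq_add_cokernel f, hl.1 (cokernel f)]

theorem lt_of_strictSubOf (hl : IsLengthFunctionCat l) {X Y : C} (h : StrictSubOf X Y) :
    l X < l Y := by
  refine lt_of_le_of_ne (hl.le_of_subOf h.1) fun he => ?_
  obtain ⟨⟨f, hf⟩, hn⟩ := h
  have h0 : l (cokernel f) = 0 := by linarith [hl.eq_add_cokernel f]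
  have : Epi f := Preadditive.epi_of_isZero_cokernel _ ((hl.2.1 _).1 h0)
  have := isIso_of_mono_of_epi f
  exact hn ⟨inv f, inferInstance⟩

end IsLengthFunctionCat

theorem SubOf.symm_of_simple {X T : C} [Simple T] (hX : ¬ IsZero X) (h : SubOf X T) :
    SubOf T X := by
  obtain ⟨f, hf⟩ := h
  have := isIso_of_mono_of_nonzero fun h0 => hX (IsZero.of_mono_eq_zero f h0)
  exact ⟨inv f, inferInstance⟩

theorem Indec.of_simple (X : C) [Simple X] : Indec X :=
  ⟨Simple.not_isZero X, fun A B ⟨e⟩ => (indecomposable_of_simple X).2 A B e⟩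

theorem exists_simple_subOf (hC : IsLengthCategory C) {X : C} (hX : ¬ IsZero X) :
    ∃ T : C, Simple T ∧ SubOf T X := by
  have : IsArtinianObject X := ⟨(hC X).1⟩
  obtain ⟨T, hT⟩ := exists_simple_subobject hX
  exact ⟨T, hT, T.arrow, inferInstance⟩

theorem lexLE_iff_forall {T : Type*} [LinearOrder T] {X Y : Finset T} :
    lexLE X Y ↔ ∀ a ∈ X \ Y, ∃ b ∈ Y \ X, b ≤ a := by
  constructor
  · rintro (h | ⟨b, hb, h⟩) a ha
    · simp [h] at ha
    · exact ⟨b, hb, h a ha⟩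
  · intro h
    rcases (X \ Y).eq_empty_or_nonempty with h0 | ⟨a, ha⟩
    · exact .inl h0
    · obtain ⟨b, hb, -⟩ := h a ha
      refine .inr ⟨(Y \ X).min' ⟨b, hb⟩, Finset.min'_mem _ _, fun a ha => ?_⟩
      obtain ⟨b, hb, hba⟩ := h a ha
      exact (Finset.min'_le _ b hb).trans hba

/-- The lexicographic order on chains is the colexicographic order for the dual order. -/
theorem lexLE_iff_toColex_le {T : Type*} [LinearOrder T] {X Y : Finset T} :
    lexLE X Y ↔ toColex (X.map OrderDual.toDual.toEmbedding) ≤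
      toColex (Y.map OrderDual.toDual.toEmbedding) := by
  rw [lexLE_iff_forall, Finset.Colex.toColex_le_toColex]
  simp [OrderDual.forall, OrderDual.exists, and_assoc]

theorem exists_lexLE_greatest {T : Type*} [LinearOrder T] {P : Set (Finset T)}
    (hP : P.Finite) (hne : P.Nonempty) : ∃ M ∈ P, ∀ X ∈ P, lexLE X M := by
  obtain ⟨M, hM, h⟩ := Set.exists_max_image P
    (fun X => toColex (X.map OrderDual.toDual.toEmbedding)) hP hne
  exact ⟨M, hM, fun X hX => lexLE_iff_toColex_le.2 (h X hX)⟩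

theorem subOf_last {n : ℕ} {Z : Fin (n + 1) → C}
    (hZ : ∀ i j : Fin (n + 1), i < j → StrictSubOf (Z i) (Z j)) (i : Fin (n + 1)) :
    SubOf (Z i) (Z (Fin.last n)) := by
  rcases (Fin.le_last i).lt_or_eq with h | rfl
  · exact (hZ _ _ h).1
  · exact ⟨𝟙 _, inferInstance⟩

/-- A length function with natural number values has a Gabriel-Roiter measure. -/
theorem exists_isGRMeasure {l : C → ℕ} (hl : IsLengthFunctionCat (fun X => (l X : ℝ))) :
    ∃ μ : C → Finset ℝ, IsGRMeasure (fun X => (l X : ℝ)) μ := by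
  have key : ∀ X : C, ∃ M : Finset ℝ, Indec X →
      (∃ (n : ℕ) (Z : Fin (n + 1) → C), (∀ i, Indec (Z i)) ∧
        (∀ i j : Fin (n + 1), i < j → StrictSubOf (Z i) (Z j)) ∧ Z (Fin.last n) = X ∧
        M = Finset.univ.image fun i => (l (Z i) : ℝ)) ∧
      (∀ (n : ℕ) (Z : Fin (n + 1) → C), (∀ i, Indec (Z i)) →
        (∀ i j : Fin (n + 1), i < j → StrictSubOf (Z i) (Z j)) → Z (Fin.last n) = X →
        lexLE (Finset.univ.image fun i => (l (Z i) : ℝ)) M) := by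
    intro X
    by_cases hX : Indec X
    swap
    · exact ⟨∅, fun h => absurd h hX⟩
    let P : Set (Finset ℝ) := {M | ∃ (n : ℕ) (Z : Fin (n + 1) → C), (∀ i, Indec (Z i)) ∧
        (∀ i j : Fin (n + 1), i < j → StrictSubOf (Z i) (Z j)) ∧ Z (Fin.last n) = X ∧
        M = Finset.univ.image fun i => (l (Z i) : ℝ)}
    have hP : P.Finite := by
      refine (Finset.finite_toSet
        ((Finset.range (l X + 1)).image (fun k : ℕ => (k : ℝ))).powerset).subset ?_
      rintro M ⟨n, Z, -, hZ, rfl, rfl⟩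
      simp only [Finset.coe_powerset, Set.mem_preimage, Set.mem_powerset_iff, Finset.coe_subset]
      intro a ha
      obtain ⟨i, -, rfl⟩ := Finset.mem_image.1 ha
      refine Finset.mem_image_of_mem (fun k : ℕ => (k : ℝ)) (Finset.mem_range.2 ?_)
      exact Nat.lt_succ_of_le (Nat.cast_le.1 (hl.le_of_subOf (subOf_last hZ i)))
    obtain ⟨M, hM, h⟩ := exists_lexLE_greatest hP
      ⟨_, 0, fun _ => X, fun _ => hX, fun i j hij => absurd hij (by omega), rfl, rfl⟩
    exact ⟨M, fun _ => ⟨hM, fun n Z h₁ h₂ h₃ => h _ ⟨n, Z, h₁, h₂, h₃, rfl⟩⟩⟩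
  choose μ hμ using key
  exact ⟨μ, hμ⟩

namespace IsGRMeasure

variable {l : C → ℝ} {μ : C → Finset ℝ}

theorem apply_mem (hμ : IsGRMeasure l μ) {X : C} (hX : Indec X) : l X ∈ μ X := by
  obtain ⟨n, Z, -, -, rfl, h⟩ := (hμ X hX).1
  rw [h]
  exact Finset.mem_image_of_mem _ (Finset.mem_univ _)

theorem eq_singleton_of_simple (hμ : IsGRMeasure l μ) (hl : IsLengthFunctionCat l) (X : C)
    [Simple X] : μ X = {l X} := by
  refine Finset.eq_singleton_iff_unique_mem.2 ⟨hμ.apply_mem (.of_simple X), fun a ha => ?_⟩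
  obtain ⟨n, Z, hZ, hs, hX, h⟩ := (hμ X (.of_simple X)).1
  rw [h] at ha
  obtain ⟨i, -, rfl⟩ := Finset.mem_image.1 ha
  have hi : SubOf (Z i) X := hX ▸ subOf_last hs i
  exact le_antisymm (hl.le_of_subOf hi) (hl.le_of_subOf (hi.symm_of_simple (hZ i).1))

theorem lexLE_pair (hμ : IsGRMeasure l μ) {X Y : C} (hX : Indec X) (hY : Indec Y)
    (h : StrictSubOf X Y) : lexLE {l X, l Y} (μ Y) := by
  have := (hμ Y hY).2 1 ![X, Y] (by simp [Fin.forall_fin_two, hX, hY])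
    (by simp [Fin.forall_fin_two, h]) rfl
  convert this using 1
  ext a
  simp [Fin.exists_fin_two, eq_comm]

end IsGRMeasure

/-- An indecomposable object `S` is simple iff there is a length function `ℓ` such that
the Gabriel-Roiter measure `ℓ*` attains its minimal value at `S`, i.e.
`ℓ*(S) ≤ ℓ*(X)` for every indecomposable `X`. -/
theorem simple_iff_gr_minimal {C : Type u} [Category.{v} C] [Abelian C]
    (hC : IsLengthCategory C) (S : C) (hS : Indec S) :
    Simple S ↔
      ∃ (l : C → ℝ) (μ : C → Finset ℝ), IsLengthFunctionCat l ∧ IsGRMeasure l μ ∧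
        ∀ X : C, Indec X → lexLE (μ S) (μ X) := by
  constructor
  · intro _
    obtain ⟨l, hl, hl1⟩ := exists_isLengthFunctionCat_natCast hC
    obtain ⟨μ, hμ⟩ := exists_isGRMeasure hl
    refine ⟨fun X => (l X : ℝ), μ, hl, hμ, fun X hX => ?_⟩
    rw [hμ.eq_singleton_of_simple hl S, hl1 S inferInstance, lexLE_iff_forall]
    obtain ⟨T, hT, hTX⟩ := exists_simple_subOf hC hX.1
    intro a ha
    obtain ⟨rfl, h1⟩ : a = ((1 : ℕ) : ℝ) ∧ a ∉ μ X := by simpa using ha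
    have hTX' : StrictSubOf T X := by
      refine ⟨hTX, fun hXT => h1 ?_⟩
      rw [← hl1 T hT, le_antisymm (hl.le_of_subOf hTX) (hl.le_of_subOf hXT)]
      exact hμ.apply_mem hX
    obtain ⟨b, hb, hb1⟩ := lexLE_iff_forall.1 (hμ.lexLE_pair (.of_simple T) hX hTX')
      ((1 : ℕ) : ℝ) (by simpa [hl1 T hT] using h1)
    have hbX := (Finset.mem_sdiff.1 hb).1
    refine ⟨b, ?_, hb1⟩
    rw [Finset.mem_sdiff, Finset.mem_singleton]
    exact ⟨hbX, fun h => h1 (h ▸ hbX)⟩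
  · rintro ⟨l, μ, hl, hμ, hmin⟩
    obtain ⟨T, hT, hTS⟩ := exists_simple_subOf hC hS.1
    by_contra hSimple
    have hTS' : StrictSubOf T S := by
      refine ⟨hTS, fun hST => hSimple ?_⟩
      obtain ⟨f, hf⟩ := hST
      have := isIso_of_mono_of_nonzero fun h0 => hS.1 (IsZero.of_mono_eq_zero f h0)
      exact Simple.of_iso (asIso f)
    have hlt := hl.lt_of_strictSubOf hTS'
    have h₁ := hmin T (.of_simple T)
    rw [hμ.eq_singleton_of_simple hl T, lexLE_iff_forall] at h₁
    obtain ⟨b, hb, -⟩ := h₁ (l S) (by simpa [hlt.ne'] using hμ.apply_mem hS)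
    obtain ⟨rfl, hTμ⟩ : b = l T ∧ b ∉ μ S := by simpa using hb
    obtain ⟨b, hb, hbT⟩ := lexLE_iff_forall.1 (hμ.lexLE_pair (.of_simple T) hS hTS') (l T)
      (by simpa using hTμ)
    have hbS := (Finset.mem_sdiff.1 hb).1
    have hbT' : b ≠ l T := fun h => hTμ (h ▸ hbS)
    obtain ⟨c, hc, hcb⟩ := h₁ b (by simpa using ⟨hbS, hbT'⟩)
    obtain ⟨rfl, -⟩ : c = l T ∧ c ∉ μ S := by simpa using hc
    exact hbT' (le_antisymm hbT hcb)
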